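/- For any skew shape A and any ℓ ≥ 2, cols(trim^{ℓ−1}(A)) = cols_ℓ(A), where trim^{ℓ−1} denotes the (ℓ−1)-fold iteration of the trim operation. -/

import Mathlib

namespace SkewPaper

open Finset

/-- A skew shape `λ/μ`, given by Young diagrams `μ ≤ λ`. -/
structure SkewShape where
  lam : YoungDiagram
  mu : YoungDiagram
  sub : mu ≤ lam

namespace SkewShape

/-- The cells (boxes) of the skew shape `λ/μ`. -/
def cells (A : SkewShape) : Finset (ℕ × ℕ) :=
  A.lam.cells \ A.mu.cells

/-- The number of boxes of `A`. -/
def size (A : SkewShape) : ℕ := A.cells.card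

end SkewShape

/-- The set of columns occupied by row `i` of the cell set `s`. -/
def rowCols (s : Finset (ℕ × ℕ)) (i : ℕ) : Finset ℕ :=
  (s.filter (fun c => c.1 = i)).image Prod.snd

/-- The set of rows occupied by column `j` of the cell set `s`. -/
def colRows (s : Finset (ℕ × ℕ)) (j : ℕ) : Finset ℕ :=
  (s.filter (fun c => c.2 = j)).image Prod.fst

/-- `overlapRow s k i` : the number of columns occupied in common by
rows `i, i+1, …, i+k-1` of `s`. -/
def overlapRow (s : Finset (ℕ × ℕ)) (k i : ℕ) : ℕ :=
  ((rowCols s i).filter (fun j => ∀ t, t < k → j ∈ rowCols s (i + t))).card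

/-- `overlapCol s l j` : the number of rows occupied in common by
columns `j, j+1, …, j+l-1` of `s`. -/
def overlapCol (s : Finset (ℕ × ℕ)) (l j : ℕ) : ℕ :=
  ((colRows s j).filter (fun i => ∀ t, t < l → i ∈ colRows s (j + t))).card

/-- `rows_k`: the partition (as the multiset of its nonzero parts) of overlaps of
`k` consecutive rows. -/
def rowsk (s : Finset (ℕ × ℕ)) (k : ℕ) : Multiset ℕ :=
  ((s.image Prod.fst).val.map (overlapRow s k)).filter (fun m => 0 < m)

/-- `cols_l`: the partition (as the multiset of its nonzero parts) of overlaps of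
`l` consecutive columns. -/
def colsk (s : Finset (ℕ × ℕ)) (l : ℕ) : Multiset ℕ :=
  ((s.image Prod.snd).val.map (overlapCol s l)).filter (fun m => 0 < m)

/-- `rects s k l`: the number of `k × l` rectangles of boxes contained inside `s`. -/
def rects (s : Finset (ℕ × ℕ)) (k l : ℕ) : ℕ :=
  (s.filter (fun c => ∀ a, a < k → ∀ b, b < l → (c.1 + a, c.2 + b) ∈ s)).card

/-- The weakly decreasing sorted list of a multiset: the partition with those parts. -/
def sortDesc (s : Multiset ℕ) : List ℕ := (s.sort (· ≤ ·)).reverse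

/-- Dominance order on partitions presented as multisets of parts:
every partial sum of the decreasing sort of `s` is at most the corresponding
partial sum for `t` (missing parts treated as `0`). -/
def Dom (s t : Multiset ℕ) : Prop :=
  ∀ j : ℕ, ((sortDesc s).take j).sum ≤ ((sortDesc t).take j).sum

/-- The conjugate (transpose) of a partition presented as a multiset of parts. -/
def conjM (s : Multiset ℕ) : Multiset ℕ :=
  (Multiset.range s.sup).map (fun j => Multiset.card (s.filter (fun x => j < x)))

/-- A standard Young tableau of shape `A`: a bijective filling of the cells of `A`
by `1, …, |A|` which increases from left to right along rows and from top to
bottom down columns.  (Entries off the shape are normalized to `0`.) -/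
structure SYT (A : SkewShape) where
  entry : ℕ × ℕ → ℕ
  zero_off : ∀ c, c ∉ A.cells → entry c = 0
  mem_range : ∀ c ∈ A.cells, entry c ∈ Finset.Icc 1 A.size
  injOn : Set.InjOn entry ↑A.cells
  row_lt : ∀ i j j', (i, j) ∈ A.cells → (i, j') ∈ A.cells → j < j' →
    entry (i, j) < entry (i, j')
  col_lt : ∀ i i' j, (i, j) ∈ A.cells → (i', j) ∈ A.cells → i < i' →
    entry (i, j) < entry (i', j)

/-- The descent set of a standard Young tableau: those `k ∈ {1, …, n-1}` such that
`k+1` appears in a strictly lower row than `k`. -/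
def SYT.descentSet {A : SkewShape} (T : SYT A) : Finset ℕ :=
  (Finset.Ico 1 A.size).filter (fun k =>
    ∃ c ∈ A.cells, ∃ c' ∈ A.cells, T.entry c = k ∧ T.entry c' = k + 1 ∧ c.1 < c'.1)

/-- The composition of `n` corresponding to a subset `D ⊆ {1, …, n-1}`:
its partial sums are the elements of `D`. -/
def compOfSet (n : ℕ) (D : Finset ℕ) : List ℕ :=
  if n = 0 then []
  else
    let l := D.sort (· ≤ ·) ++ [n]
    List.zipWith (fun x y => x - y) l (0 :: l)

/-- The descent composition of a standard Young tableau. -/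
def SYT.descentComp {A : SkewShape} (T : SYT A) : List ℕ :=
  compOfSet A.size T.descentSet

/-- The F-support of `A`: the set of descent compositions of SYT of shape `A`. -/
def Fsupp (A : SkewShape) : Set (List ℕ) :=
  {α | ∃ T : SYT A, T.descentComp = α}

/-- The number of standard Young tableaux of shape `A` with descent composition `α`. -/
noncomputable def countSYT (A : SkewShape) (α : List ℕ) : ℕ :=
  Nat.card {T : SYT A // T.descentComp = α}

/-- `S(γ)`: the set of proper partial sums of the composition `γ`. -/
def Sset (γ : List ℕ) : Finset ℕ :=
  ((List.range (γ.length - 1)).map (fun j => (γ.take (j + 1)).sum)).toFinset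

/-- `cols(α)` for a composition `α` of `n`, as a multiset: the parts of the
composition corresponding to the complement of `S(α)` in `{1, …, n-1}`. -/
def colsComp (α : List ℕ) : Multiset ℕ :=
  ↑(compOfSet α.sum ((Finset.Icc 1 (α.sum - 1)) \ Sset α))

/-- Delete the leftmost box of every nonempty row. -/
def trimCells (s : Finset (ℕ × ℕ)) : Finset (ℕ × ℕ) :=
  s.filter (fun c => 1 ≤ c.2 ∧ (c.1, c.2 - 1) ∈ s)

/-- `s` is a ribbon whose (nonempty) rows are exactly rows `r0, …, r1`, with every
pair of adjacent rows overlapping in exactly one column. -/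
def IsRibbonOn (s : Finset (ℕ × ℕ)) (r0 r1 : ℕ) : Prop :=
  r0 ≤ r1 ∧ (∀ i, (rowCols s i).Nonempty ↔ r0 ≤ i ∧ i ≤ r1) ∧
    (∀ i, r0 ≤ i → i < r1 → (rowCols s i ∩ rowCols s (i + 1)).card = 1)

/-- `A` is a ribbon. -/
def SkewShape.IsRibbon (A : SkewShape) : Prop :=
  ∃ r0 r1, IsRibbonOn A.cells r0 r1

/-- An elongated ribbon: a ribbon all of whose rows have length at least two. -/
def ElongatedRibbon (A : SkewShape) : Prop :=
  A.IsRibbon ∧ ∀ i, (rowCols A.cells i).Nonempty → 2 ≤ (rowCols A.cells i).card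

/-- A horizontal strip: at most one box in each column. -/
def IsHorizontalStrip (A : SkewShape) : Prop :=
  ∀ j, (colRows A.cells j).card ≤ 1

/-- `A` is F-multiplicity-free: distinct SYT of shape `A` have distinct descent sets. -/
def FMultFree (A : SkewShape) : Prop :=
  ∀ T T' : SYT A, T.descentSet = T'.descentSet → T = T'

/-- The cells of a shape, viewed inside `ℤ × ℤ`. -/
def toZ (s : Finset (ℕ × ℕ)) : Finset (ℤ × ℤ) :=
  s.image (fun c => ((c.1 : ℤ), (c.2 : ℤ)))

/-- The cells of the hook `(m, 1^l)`. -/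
def hookCells (m l : ℕ) : Finset (ℕ × ℕ) :=
  ((Finset.range m).image (fun j => ((0 : ℕ), j))) ∪
    ((Finset.Icc 1 l).image (fun i => (i, (0 : ℕ))))


theorem mem_colRows {s : Finset (ℕ × ℕ)} {i j : ℕ} : i ∈ colRows s j ↔ (i, j) ∈ s := by
  simp [colRows]

theorem mem_trimCells_iterate (s : Finset (ℕ × ℕ)) (n i j : ℕ) :
    (i, j) ∈ trimCells^[n] s ↔ n ≤ j ∧ ∀ t ≤ n, (i, j - t) ∈ s := by
  induction n generalizing j with
  | zero => simp
  | succ n ih =>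
    rw [Function.iterate_succ_apply', trimCells, mem_filter]
    simp only [ih]
    constructor
    · rintro ⟨⟨_, h⟩, h1, h2, h3⟩
      refine ⟨by omega, fun t ht => ?_⟩
      rcases Nat.lt_or_ge n t with hlt | hle
      · have := h3 n le_rfl
        rwa [show j - t = j - 1 - n by omega]
      · exact h t hle
    · rintro ⟨h1, h2⟩
      refine ⟨⟨by omega, fun t ht => h2 t (by omega)⟩, by omega, by omega, fun t ht => ?_⟩
      rw [show j - 1 - t = j - (t + 1) by omega]
      exact h2 _ (by omega)

theorem overlapCol_trimCells_iterate (s : Finset (ℕ × ℕ)) (n j : ℕ) :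
    overlapCol (trimCells^[n] s) 1 (j + n) = overlapCol s (n + 1) j := by
  unfold overlapCol
  congr 1
  ext i
  simp only [mem_filter, mem_colRows, mem_trimCells_iterate]
  constructor
  · rintro ⟨⟨_, h⟩, -⟩
    have key : ∀ t < n + 1, (i, j + t) ∈ s := fun t ht => by
      have := h (n - t) (by omega)
      rwa [show j + n - (n - t) = j + t by omega] at this
    exact ⟨key 0 (by omega), key⟩
  · rintro ⟨-, h⟩
    have key : n ≤ j + n ∧ ∀ t ≤ n, (i, j + n - t) ∈ s := ⟨by omega, fun t ht => by
      have := h (n - t) (by omega)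
      rwa [show j + (n - t) = j + n - t by omega] at this⟩
    refine ⟨key, fun t ht => ?_⟩
    obtain rfl : t = 0 := by omega
    exact key

theorem mem_image_snd_of_overlapCol_pos {s : Finset (ℕ × ℕ)} {l j : ℕ}
    (h : 0 < overlapCol s l j) : j ∈ s.image Prod.snd := by
  obtain ⟨i, hi⟩ := card_pos.1 h
  exact mem_image.2 ⟨(i, j), mem_colRows.1 (mem_filter.1 hi).1, rfl⟩

theorem colsk_trimCells_iterate (s : Finset (ℕ × ℕ)) (n : ℕ) :
    colsk (trimCells^[n] s) 1 = colsk s (n + 1) := by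
  have columns : ((trimCells^[n] s).image Prod.snd).filter
        (fun j => 0 < overlapCol (trimCells^[n] s) 1 j) =
      ((s.image Prod.snd).filter (fun j => 0 < overlapCol s (n + 1) j)).map
        (addRightEmbedding n) := by
    ext j
    simp only [mem_map, addRightEmbedding_apply]
    constructor
    · intro hj
      obtain ⟨hj, hpos⟩ := mem_filter.1 hj
      obtain ⟨⟨i, j⟩, hc, rfl⟩ := mem_image.1 hj
      obtain ⟨k, rfl⟩ := Nat.exists_eq_add_of_le' ((mem_trimCells_iterate s n i j).1 hc).1
      rw [overlapCol_trimCells_iterate] at hpos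
      exact ⟨k, mem_filter.2 ⟨mem_image_snd_of_overlapCol_pos hpos, hpos⟩, rfl⟩
    · rintro ⟨k, hk, rfl⟩
      have hpos := (mem_filter.1 hk).2
      rw [← overlapCol_trimCells_iterate] at hpos
      exact mem_filter.2 ⟨mem_image_snd_of_overlapCol_pos hpos, hpos⟩
  have h := congrArg (fun t => t.val.map (overlapCol (trimCells^[n] s) 1)) columns
  simpa [colsk, Multiset.filter_map, Function.comp_def, overlapCol_trimCells_iterate] using h

theorem stmt11 (A : SkewShape) (l : ℕ) (hl : 2 ≤ l) :
    colsk (trimCells^[l - 1] A.cells) 1 = colsk A.cells l := by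
  rw [colsk_trimCells_iterate, Nat.sub_add_cancel (by omega)]

end SkewPaper
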